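/- Let c, w, ℓ, v, D be positive integers with D dividing v, and identify [v] with [D]×[v/D] via (z,e) ↦ z + D·(e−1). Let E:[v^c]×[D] → [v/D] be a ((c·log₂ v)/2, ε)-strong extractor, and let G_ℓ:[D]^ℓ → [D]^w be a function such that for y uniform on [D]^ℓ, the coordinates G_ℓ(y)_1,…,G_ℓ(y)_w are ℓ-wise independent, each uniform on [D]. Define G:[v^c]×[D]^ℓ → [v]^w by G(x,y)_i = ( G_ℓ(y)_i , E(x, G_ℓ(y)_i) ) ∈ [D]×[v/D] ≅ [v]. Let f_1,…,f_w:[v] → [0,1] be functions with Σ_{i=1}^w E_{z uniform on [v]}[f_i(z)] = μ, and let α = G(x,y) for (x,y) uniform on [v^c]×[D]^ℓ. Then for all θ ≥ 0, E_α[ exp( θ·Σ_{i=1}^w f_i(α_i) ) ] ≤ exp(e^θ·w·ε)·exp(e^θ·μ) + exp(2·θ·w)·( e·(μ + w·ε)/ℓ )^ℓ + exp(θ·w)·w·v^{−c/2}. -/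

import Mathlib

open Finset

-- `E` is a `(k,ε)`-strong extractor: for every source with min-entropy ≥ k (all point masses
-- ≤ 2^(-k)), the pair (seed, output) is ε-close in total variation to uniform.
open Classical in
noncomputable def strongExtractor {N D M : Type*} [Fintype N] [Fintype D] [Fintype M]
    (E : N → D → M) (k ε : ℝ) : Prop :=
  ∀ p : N → ℝ, (∀ x, 0 ≤ p x) → (∑ x, p x) = 1 →
    (∀ x, p x ≤ (2:ℝ) ^ (-k)) →
    (1/2) * (∑ z : D, ∑ m : M,
      |(∑ x, if E x z = m then p x else 0) / (Fintype.card D) -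
        1 / ((Fintype.card D : ℝ) * (Fintype.card M))|) ≤ ε

/-- The identification `[D] × [m] ≅ [D·m]`, `(z,e) ↦ z + D·e` (0-indexed). -/
def encodeFin {D m : ℕ} (z : Fin D) (e : Fin m) : Fin (D * m) :=
  ⟨z.1 + D * e.1, by
    have hz := z.2
    have he : e.1 + 1 ≤ m := e.2
    calc z.1 + D * e.1 < D + D * e.1 := by omega
      _ = D * (e.1 + 1) := by ring
      _ ≤ D * m := Nat.mul_le_mul (Nat.le_refl D) he⟩

/-- For `y` uniform, the coordinates of `Gl y` are `ℓ`-wise independent, each uniform on `[D]`. -/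
def lWiseUniformF {ℓ w D : ℕ} (Gl : (Fin ℓ → Fin D) → Fin w → Fin D) : Prop :=
  ∀ S : Finset (Fin w), S.card ≤ ℓ → ∀ σ : Fin w → Fin D,
    (Nat.card {y : Fin ℓ → Fin D // ∀ i ∈ S, Gl y i = σ i} : ℝ) / (D:ℝ) ^ ℓ
      = (1 / (D:ℝ)) ^ S.card

/-- Every product of `ℓ`-subsets sums to at most `(e · M / ℓ) ^ ℓ`. -/
theorem sum_powersetCard_prod_le {ι : Type*} [Fintype ι] (m : ι → ℝ) (hm : ∀ i, 0 ≤ m i)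
    {M : ℝ} (hM : ∑ i, m i ≤ M) {ℓ : ℕ} (hℓ : 0 < ℓ) :
    ∑ S ∈ (univ : Finset ι).powersetCard ℓ, ∏ i ∈ S, m i ≤ (Real.exp 1 * M / ℓ) ^ ℓ := by
  have hM0 : 0 ≤ M := (sum_nonneg fun i _ => hm i).trans hM
  have hℓ' : (0 : ℝ) < ℓ := by exact_mod_cast hℓ
  rcases hM0.eq_or_lt with rfl | hMpos
  · have hz : ∀ i, m i = 0 := fun i =>
      le_antisymm ((single_le_sum (fun j _ => hm j) (mem_univ i)).trans hM) (hm i)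
    rw [sum_eq_zero]
    · positivity
    · intro S hS
      obtain ⟨i, hi⟩ : S.Nonempty := by
        rw [← card_pos, (mem_powersetCard.1 hS).2]
        exact hℓ
      exact prod_eq_zero hi (hz i)
  · set s : ℝ := ℓ / M with hs
    have hspos : 0 < s := by positivity
    have h1 : s ^ ℓ * ∑ S ∈ (univ : Finset ι).powersetCard ℓ, ∏ i ∈ S, m i ≤ Real.exp ℓ := by
      calc s ^ ℓ * ∑ S ∈ (univ : Finset ι).powersetCard ℓ, ∏ i ∈ S, m i
          = ∑ S ∈ (univ : Finset ι).powersetCard ℓ, ∏ i ∈ S, (s * m i) := by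
            rw [mul_sum]
            refine sum_congr rfl fun S hS => ?_
            rw [prod_mul_distrib, prod_const, (mem_powersetCard.1 hS).2]
        _ ≤ ∑ S ∈ (univ : Finset ι).powerset, ∏ i ∈ S, (s * m i) := by
            refine sum_le_sum_of_subset_of_nonneg
              (fun S _ => mem_powerset.2 (subset_univ S)) fun S _ _ => ?_
            exact prod_nonneg fun i _ => mul_nonneg hspos.le (hm i)
        _ = ∏ i, (1 + s * m i) := (prod_one_add _).symm
        _ ≤ ∏ i, Real.exp (s * m i) := by
            refine prod_le_prod (fun i _ => by have := hm i; positivity) fun i _ => ?_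
            linarith [Real.add_one_le_exp (s * m i)]
        _ = Real.exp (s * ∑ i, m i) := by rw [← Real.exp_sum, mul_sum]
        _ ≤ Real.exp ℓ := by
            refine Real.exp_le_exp.2 ?_
            calc s * ∑ i, m i ≤ s * M := by gcongr
              _ = ℓ := by rw [hs]; field_simp
    have h2 : (Real.exp 1 * M / ℓ) ^ ℓ = Real.exp ℓ / s ^ ℓ := by
      rw [hs, ← Real.exp_one_pow, ← div_pow]
      congr 1
      field_simp
    rw [h2, le_div_iff₀ (by positivity), mul_comm]
    exact h1

/-- Truncated expansion of the moment generating function of variables in `[0,1]`. -/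
theorem exp_sum_le_truncated {ι : Type*} [Fintype ι] (Z : ι → ℝ) (hZ0 : ∀ i, 0 ≤ Z i)
    (hZ1 : ∀ i, Z i ≤ 1) {θ : ℝ} (hθ : 0 ≤ θ) (ℓ : ℕ) :
    Real.exp (θ * ∑ i, Z i) ≤
      (∑ S ∈ (univ : Finset ι).powerset with S.card ≤ ℓ,
          (Real.exp θ - 1) ^ S.card * ∏ i ∈ S, Z i) +
        Real.exp (θ * Fintype.card ι) *
          ∑ T ∈ (univ : Finset ι).powersetCard ℓ, ∏ i ∈ T, Z i := by
  set t : ℝ := Real.exp θ - 1 with ht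
  have ht0 : 0 ≤ t := by linarith [Real.add_one_le_exp θ]
  have hconv : ∀ i, Real.exp (θ * Z i) ≤ 1 + t * Z i := by
    intro i
    have h := convexOn_exp.2 (Set.mem_univ 0) (Set.mem_univ θ)
      (sub_nonneg.2 (hZ1 i)) (hZ0 i) (by ring)
    simp only [smul_eq_mul, mul_zero, zero_add, Real.exp_zero, mul_one] at h
    rw [mul_comm θ]
    rw [ht]
    linarith
  have hexp : Real.exp (θ * Fintype.card ι) = ∑ S ∈ (univ : Finset ι).powerset, t ^ S.card := by
    have h := prod_one_add (f := fun _ : ι => t) univ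
    simp only [prod_const] at h
    rw [← h, ht, mul_comm, Real.exp_nat_mul, card_univ]
    congr 1
    ring
  have hprod : ∀ S : Finset ι, 0 ≤ ∏ i ∈ S, Z i := fun S => prod_nonneg fun i _ => hZ0 i
  calc Real.exp (θ * ∑ i, Z i) = ∏ i, Real.exp (θ * Z i) := by rw [mul_sum, Real.exp_sum]
    _ ≤ ∏ i, (1 + t * Z i) := prod_le_prod (fun i _ => (Real.exp_pos _).le) fun i _ => hconv i
    _ = ∑ S ∈ (univ : Finset ι).powerset, t ^ S.card * ∏ i ∈ S, Z i := by
        rw [prod_one_add]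
        refine sum_congr rfl fun S _ => ?_
        rw [prod_mul_distrib, prod_const]
    _ = (∑ S ∈ (univ : Finset ι).powerset with S.card ≤ ℓ, t ^ S.card * ∏ i ∈ S, Z i) +
        ∑ S ∈ (univ : Finset ι).powerset with ¬ S.card ≤ ℓ, t ^ S.card * ∏ i ∈ S, Z i :=
        (sum_filter_add_sum_filter_not _ _ _).symm
    _ ≤ _ := by
        gcongr
        rw [hexp, sum_mul]
        calc ∑ S ∈ (univ : Finset ι).powerset with ¬ S.card ≤ ℓ, t ^ S.card * ∏ i ∈ S, Z i
            ≤ ∑ S ∈ (univ : Finset ι).powerset with ¬ S.card ≤ ℓ, t ^ S.card *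
                ∑ T ∈ (univ : Finset ι).powersetCard ℓ, ∏ i ∈ T, Z i := by
              refine sum_le_sum fun S hS => ?_
              have hc : ℓ ≤ S.card := (not_le.1 (mem_filter.1 hS).2).le
              obtain ⟨T, hTS, hT⟩ := exists_subset_card_eq hc
              refine mul_le_mul_of_nonneg_left ?_ (by positivity)
              calc ∏ i ∈ S, Z i ≤ ∏ i ∈ T, Z i := by
                    classical
                    rw [← prod_sdiff hTS]
                    exact mul_le_of_le_one_left (hprod T)
                      (prod_le_one (fun i _ => hZ0 i) fun i _ => hZ1 i)
                _ ≤ _ := single_le_sum (f := fun T => ∏ i ∈ T, Z i) (fun T _ => hprod T)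
                    (mem_powersetCard.2 ⟨subset_univ T, hT⟩)
          _ ≤ _ := by
              refine sum_le_sum_of_subset_of_nonneg (filter_subset _ _) fun S _ _ => ?_
              exact mul_nonneg (by positivity) (sum_nonneg fun T _ => hprod T)

/-- The expectation of a product of at most `ℓ` factors splits. -/
theorem lWiseUniformF.sum_prod {ℓ w D : ℕ} {Gl : (Fin ℓ → Fin D) → Fin w → Fin D}
    (hGl : lWiseUniformF Gl) (hD : 0 < D) (g : Fin w → Fin D → ℝ) (S : Finset (Fin w))
    (hS : S.card ≤ ℓ) :
    (∑ y, ∏ i ∈ S, g i (Gl y i)) / (D : ℝ) ^ ℓ = ∏ i ∈ S, (∑ z, g i z) / D := by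
  have hD' : (D : ℝ) ≠ 0 := by exact_mod_cast hD.ne'
  have hcount : ∀ τ : S → Fin D,
      ((univ.filter fun y => (fun i : S => Gl y i) = τ).card : ℝ) =
        (1 / (D : ℝ)) ^ S.card * (D : ℝ) ^ ℓ := by
    intro τ
    have h := hGl S hS fun i => if h : i ∈ S then τ ⟨i, h⟩ else ⟨0, hD⟩
    rw [div_eq_iff (by positivity)] at h
    rw [← h, Nat.card_eq_fintype_card, Fintype.card_subtype]
    congr 2
    ext y
    simp only [mem_filter, mem_univ, true_and, funext_iff, Subtype.forall]
    refine forall₂_congr fun i hi => ?_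
    rw [dif_pos hi]
  have hsum : ∑ y, ∏ i ∈ S, g i (Gl y i) =
      ∑ τ : S → Fin D, (1 / (D : ℝ)) ^ S.card * (D : ℝ) ^ ℓ * ∏ i : S, g i (τ i) := by
    rw [← sum_fiberwise univ (fun y => (fun i : S => Gl y i))]
    refine sum_congr rfl fun τ _ => ?_
    rw [← hcount τ, ← nsmul_eq_mul, ← sum_const]
    refine sum_congr rfl fun y hy => ?_
    rw [← prod_coe_sort, ← (mem_filter.1 hy).2]
  rw [hsum, ← mul_sum, ← Fintype.prod_sum (fun (i : S) z => g i z),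
    prod_coe_sort S (fun i => ∑ z, g i z), prod_div_distrib, prod_const, one_div,
    inv_pow]
  field_simp

/-- Moment generating function bound for a sum of `ℓ`-wise independent variables in `[0,1]`. -/
theorem lWiseUniformF.mgf_le {ℓ w D : ℕ} {Gl : (Fin ℓ → Fin D) → Fin w → Fin D}
    (hGl : lWiseUniformF Gl) (hD : 0 < D) (hℓ : 0 < ℓ) (g : Fin w → Fin D → ℝ)
    (hg0 : ∀ i z, 0 ≤ g i z) (hg1 : ∀ i z, g i z ≤ 1) {M : ℝ}
    (hM : ∑ i, (∑ z, g i z) / D ≤ M) {θ : ℝ} (hθ : 0 ≤ θ) :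
    (∑ y, Real.exp (θ * ∑ i, g i (Gl y i))) / (D : ℝ) ^ ℓ ≤
      Real.exp ((Real.exp θ - 1) * M) + Real.exp (θ * w) * (Real.exp 1 * M / ℓ) ^ ℓ := by
  set t : ℝ := Real.exp θ - 1 with ht
  have ht0 : 0 ≤ t := by linarith [Real.add_one_le_exp θ]
  set m : Fin w → ℝ := fun i => (∑ z, g i z) / D with hm
  have hm0 : ∀ i, 0 ≤ m i := fun i => div_nonneg (sum_nonneg fun z _ => hg0 i z) (by positivity)
  have hlow : ∑ S ∈ (univ : Finset (Fin w)).powerset with S.card ≤ ℓ,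
      t ^ S.card * ∏ i ∈ S, m i ≤ Real.exp (t * M) := by
    calc _ ≤ ∑ S ∈ (univ : Finset (Fin w)).powerset, t ^ S.card * ∏ i ∈ S, m i :=
          sum_le_sum_of_subset_of_nonneg (filter_subset _ _) fun S _ _ =>
            mul_nonneg (by positivity) (prod_nonneg fun i _ => hm0 i)
      _ = ∏ i, (1 + t * m i) := by
          rw [prod_one_add]
          refine sum_congr rfl fun S _ => ?_
          rw [prod_mul_distrib, prod_const]
      _ ≤ ∏ i, Real.exp (t * m i) := by
          refine prod_le_prod (fun i _ => by have := hm0 i; positivity) fun i _ => ?_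
          linarith [Real.add_one_le_exp (t * m i)]
      _ = Real.exp (t * ∑ i, m i) := by rw [← Real.exp_sum, mul_sum]
      _ ≤ Real.exp (t * M) := by gcongr
  calc (∑ y, Real.exp (θ * ∑ i, g i (Gl y i))) / (D : ℝ) ^ ℓ
      ≤ (∑ y, ((∑ S ∈ (univ : Finset (Fin w)).powerset with S.card ≤ ℓ,
            t ^ S.card * ∏ i ∈ S, g i (Gl y i)) + Real.exp (θ * w) *
            ∑ T ∈ (univ : Finset (Fin w)).powersetCard ℓ, ∏ i ∈ T, g i (Gl y i))) /
          (D : ℝ) ^ ℓ := by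
        gcongr with y
        simpa using exp_sum_le_truncated (fun i => g i (Gl y i)) (fun i => hg0 _ _)
          (fun i => hg1 _ _) hθ ℓ
    _ = (∑ S ∈ (univ : Finset (Fin w)).powerset with S.card ≤ ℓ, t ^ S.card *
            ((∑ y, ∏ i ∈ S, g i (Gl y i)) / (D : ℝ) ^ ℓ)) + Real.exp (θ * w) *
          ∑ T ∈ (univ : Finset (Fin w)).powersetCard ℓ,
            (∑ y, ∏ i ∈ T, g i (Gl y i)) / (D : ℝ) ^ ℓ := by
        rw [sum_add_distrib, add_div, sum_comm, sum_div, ← mul_sum, sum_comm, mul_div_assoc,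
          sum_div]
        congr 1
        refine sum_congr rfl fun S _ => ?_
        rw [← mul_sum, mul_div_assoc]
    _ = (∑ S ∈ (univ : Finset (Fin w)).powerset with S.card ≤ ℓ, t ^ S.card * ∏ i ∈ S, m i) +
          Real.exp (θ * w) * ∑ T ∈ (univ : Finset (Fin w)).powersetCard ℓ, ∏ i ∈ T, m i := by
        congr 1
        · refine sum_congr rfl fun S hS => ?_
          rw [hGl.sum_prod hD g S (mem_filter.1 hS).2]
        · congr 1
          refine sum_congr rfl fun T hT => ?_
          rw [hGl.sum_prod hD g T (mem_powersetCard.1 hT).2.le]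
    _ ≤ _ := by
        gcongr
        exact sum_powersetCard_prod_le m hm0 hM hℓ

/-- A test function with values in `[0,1]` cannot distinguish the output of a strong extractor
from uniform by more than `ε`. -/
theorem strongExtractor.sum_test_le {N D M : Type*} [Fintype N] [Fintype D] [Fintype M]
    [Nonempty D] [Nonempty M] {E : N → D → M} {k ε : ℝ} (hE : strongExtractor E k ε)
    (p : N → ℝ) (hp0 : ∀ x, 0 ≤ p x) (hp1 : ∑ x, p x = 1) (hpk : ∀ x, p x ≤ (2 : ℝ) ^ (-k))
    (h : D → M → ℝ) (h0 : ∀ z m, 0 ≤ h z m) (h1 : ∀ z m, h z m ≤ 1) :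
    ∑ x, p x * ((∑ z, h z (E x z)) / Fintype.card D) ≤
      (∑ z, ∑ m, h z m) / (Fintype.card D * Fintype.card M) + ε := by
  classical
  have hcD : (Fintype.card D : ℝ) ≠ 0 := by exact_mod_cast Fintype.card_ne_zero
  have hcM : (Fintype.card M : ℝ) ≠ 0 := by exact_mod_cast Fintype.card_ne_zero
  set P : D → M → ℝ := fun z m => (∑ x, if E x z = m then p x else 0) / (Fintype.card D)
    with hP
  set u : ℝ := 1 / ((Fintype.card D : ℝ) * (Fintype.card M)) with hu
  have hTV : (1/2) * ∑ z, ∑ m, |P z m - u| ≤ ε := by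
    have := hE p hp0 hp1 hpk
    convert this using 8
  have hexpect : ∀ q : D → M → ℝ,
      ∑ z, ∑ m, q z m * P z m = ∑ x, p x * ((∑ z, q z (E x z)) / Fintype.card D) := by
    intro q
    have hz : ∀ z, ∑ m, q z m * P z m = ∑ x, p x * (q z (E x z) / Fintype.card D) := by
      intro z
      simp only [hP, ← mul_div_assoc, ← sum_div, mul_sum]
      rw [sum_comm]
      congr 1
      refine sum_congr rfl fun x _ => ?_
      simp [mul_comm]
    simp only [hz]
    rw [sum_comm]
    simp only [sum_div, mul_sum]
  have hPsum : ∑ z, ∑ m, P z m = 1 := by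
    have := hexpect fun _ _ => 1
    simpa [hcD, hp1] using this
  have husum : ∑ _z : D, ∑ _m : M, u = 1 := by
    simp only [sum_const, card_univ, nsmul_eq_mul, hu]
    field_simp
  have hdiff : ∑ z, ∑ m, h z m * P z m - ∑ z, ∑ m, h z m * u =
      ∑ z, ∑ m, (h z m - 1/2) * (P z m - u) := by
    have hzero : ∑ z, ∑ m, (P z m - u) = 0 := by
      simp only [sum_sub_distrib] at husum ⊢
      rw [hPsum, husum, sub_self]
    have : ∑ z, ∑ m, (h z m - 1/2) * (P z m - u) =
        ∑ z, ∑ m, (h z m * P z m - h z m * u) - 1/2 * ∑ z, ∑ m, (P z m - u) := by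
      simp only [mul_sum, ← sum_sub_distrib]
      refine sum_congr rfl fun z _ => sum_congr rfl fun m _ => ?_
      ring
    rw [this, hzero]
    simp only [sum_sub_distrib]
    ring
  have hbound : ∑ z, ∑ m, (h z m - 1/2) * (P z m - u) ≤ (1/2) * ∑ z, ∑ m, |P z m - u| := by
    simp only [mul_sum]
    refine sum_le_sum fun z _ => sum_le_sum fun m _ => ?_
    refine (le_abs_self _).trans ?_
    rw [abs_mul]
    refine mul_le_mul_of_nonneg_right ?_ (abs_nonneg _)
    rw [abs_le]
    constructor <;> linarith [h0 z m, h1 z m]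
  have hunif : ∑ z, ∑ m, h z m * u =
      (∑ z, ∑ m, h z m) / (Fintype.card D * Fintype.card M) := by
    simp only [hu, mul_one_div, sum_div]
  rw [← hexpect, ← hunif]
  linarith

/-- Few source points violate a given test by more than `ε`. -/
theorem strongExtractor.card_bad_lt {N D M : Type*} [Fintype N] [Fintype D] [Fintype M]
    [Nonempty D] [Nonempty M] {E : N → D → M} {k ε : ℝ} (hE : strongExtractor E k ε)
    (h : D → M → ℝ) (h0 : ∀ z m, 0 ≤ h z m) (h1 : ∀ z m, h z m ≤ 1) (B : Finset N)
    (hB : ∀ x ∈ B, (∑ z, ∑ m, h z m) / (Fintype.card D * Fintype.card M) + ε <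
      (∑ z, h z (E x z)) / Fintype.card D) :
    (B.card : ℝ) < (2 : ℝ) ^ k := by
  classical
  by_contra! hcard
  have hpos : (0 : ℝ) < B.card := (Real.rpow_pos_of_pos two_pos k).trans_le hcard
  have hne : B.Nonempty := card_pos.1 (by exact_mod_cast hpos)
  have hle := hE.sum_test_le (fun x => if x ∈ B then (B.card : ℝ)⁻¹ else 0)
    (fun x => by positivity) (by simp [hpos.ne']) (fun x => by
      have : (B.card : ℝ)⁻¹ ≤ (2 : ℝ) ^ (-k) := by
        rw [Real.rpow_neg two_pos.le]
        exact inv_anti₀ (by positivity) hcard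
      split_ifs
      · exact this
      · positivity) h h0 h1
  simp only [ite_mul, zero_mul, sum_ite_mem, univ_inter, ← mul_sum] at hle
  have hlt := sum_lt_sum_of_nonempty hne hB
  rw [sum_const, nsmul_eq_mul] at hlt
  rw [inv_mul_le_iff₀ hpos] at hle
  linarith

theorem encodeFin_bijective {D v : ℕ} (hdvd : D ∣ v) (hD : 0 < D) :
    Function.Bijective fun q : Fin D × Fin (v / D) =>
      Fin.cast (Nat.mul_div_cancel' hdvd) (encodeFin q.1 q.2) := by
  rw [Fintype.bijective_iff_injective_and_card]
  constructor
  · rintro ⟨z, e⟩ ⟨z', e'⟩ h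
    have h' : z.1 + D * e.1 = z'.1 + D * e'.1 := by
      simpa [encodeFin, Fin.ext_iff] using h
    have hz : z.1 = z'.1 := by
      have := congrArg (· % D) h'
      simpa [Nat.add_mul_mod_self_left, Nat.mod_eq_of_lt z.2, Nat.mod_eq_of_lt z'.2] using this
    rw [hz] at h'
    have he : e.1 = e'.1 := Nat.eq_of_mul_eq_mul_left hD (by omega)
    exact Prod.ext (Fin.ext hz) (Fin.ext he)
  · simp [Nat.mul_div_cancel' hdvd]


theorem statement10 (c w ℓ v D : ℕ) (hc : 0 < c) (hw : 0 < w) (hℓ : 0 < ℓ)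
    (hD : 0 < D) (hv : 0 < v) (hdvd : D ∣ v)
    (ε : ℝ) (hε : 0 ≤ ε)
    (E : Fin (v^c) → Fin D → Fin (v/D))
    (hE : strongExtractor E (c * Real.logb 2 v / 2) ε)
    (Gl : (Fin ℓ → Fin D) → Fin w → Fin D) (hGl : lWiseUniformF Gl)
    (f : Fin w → Fin v → ℝ) (hf : ∀ i z, 0 ≤ f i z ∧ f i z ≤ 1)
    (μ : ℝ) (hμ : (∑ i, (∑ z, f i z) / v) = μ)
    (θ : ℝ) (hθ : 0 ≤ θ) :
    (∑ x : Fin (v^c), ∑ y : Fin ℓ → Fin D,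
        Real.exp (θ * ∑ i, f i (Fin.cast (Nat.mul_div_cancel' hdvd)
          (encodeFin (Gl y i) (E x (Gl y i)))))) / ((v:ℝ)^c * (D:ℝ)^ℓ) ≤
      Real.exp (Real.exp θ * w * ε) * Real.exp (Real.exp θ * μ) +
        Real.exp (2 * θ * w) * (Real.exp 1 * (μ + w * ε) / ℓ) ^ ℓ +
        Real.exp (θ * w) * w * (v:ℝ) ^ (-(c:ℝ)/2) := by
  classical
  set φ : Fin D → Fin (v / D) → Fin v := fun z e =>
    Fin.cast (Nat.mul_div_cancel' hdvd) (encodeFin z e) with hφ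
  have hvD : 0 < v / D := Nat.div_pos (Nat.le_of_dvd hv hdvd) hD
  have : Nonempty (Fin D) := ⟨⟨0, hD⟩⟩
  have : Nonempty (Fin (v / D)) := ⟨⟨0, hvD⟩⟩
  have hvR : (0 : ℝ) < v := by exact_mod_cast hv
  have hDR : (0 : ℝ) < D := by exact_mod_cast hD
  have hcardv : (D : ℝ) * (v / D : ℕ) = v := by
    exact_mod_cast Nat.mul_div_cancel' hdvd
  have havg : ∀ i, (∑ z, ∑ m, f i (φ z m)) /
      (Fintype.card (Fin D) * Fintype.card (Fin (v / D))) = (∑ z, f i z) / v := by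
    intro i
    rw [Fintype.card_fin, Fintype.card_fin, hcardv, ← Fintype.sum_prod_type']
    congr 1
    exact (encodeFin_bijective hdvd hD).sum_comp (f i)
  set bad : Fin w → Finset (Fin (v ^ c)) := fun i =>
    univ.filter fun x => (∑ z, f i z) / v + ε < (∑ z, f i (φ z (E x z))) / D with hbad
  have hpow : (2 : ℝ) ^ (c * Real.logb 2 v / 2) = (v : ℝ) ^ ((c : ℝ) / 2) := by
    rw [show (c : ℝ) * Real.logb 2 v / 2 = Real.logb 2 v * ((c : ℝ) / 2) by ring,
      Real.rpow_mul two_pos.le, Real.rpow_logb two_pos (by norm_num) hvR]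
  have hbadcard : ∀ i, ((bad i).card : ℝ) ≤ (v : ℝ) ^ ((c : ℝ) / 2) := by
    intro i
    rw [← hpow]
    refine (hE.card_bad_lt (fun z m => f i (φ z m)) (fun z m => (hf i _).1)
      (fun z m => (hf i _).2) (bad i) fun x hx => ?_).le
    rw [havg, Fintype.card_fin]
    exact (mem_filter.1 hx).2
  set B : Finset (Fin (v ^ c)) := univ.biUnion bad with hBdef
  have hBcard : (B.card : ℝ) ≤ w * (v : ℝ) ^ ((c : ℝ) / 2) := by
    calc (B.card : ℝ) ≤ ∑ i, ((bad i).card : ℝ) := by exact_mod_cast card_biUnion_le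
      _ ≤ ∑ _i : Fin w, (v : ℝ) ^ ((c : ℝ) / 2) := sum_le_sum fun i _ => hbadcard i
      _ = _ := by simp
  set F : Fin (v ^ c) → ℝ := fun x =>
    (∑ y, Real.exp (θ * ∑ i, f i (φ (Gl y i) (E x (Gl y i))))) / (D : ℝ) ^ ℓ with hF
  have hμ0 : 0 ≤ μ := hμ ▸ sum_nonneg fun i _ =>
    div_nonneg (sum_nonneg fun z _ => (hf i z).1) hvR.le
  have hM0 : 0 ≤ μ + w * ε := by positivity
  set A : ℝ := Real.exp (Real.exp θ * w * ε) * Real.exp (Real.exp θ * μ) +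
    Real.exp (2 * θ * w) * (Real.exp 1 * (μ + w * ε) / ℓ) ^ ℓ with hA
  have hA0 : 0 ≤ A := by positivity
  have hFgood : ∀ x ∉ B, F x ≤ A := by
    intro x hx
    have hmean : ∑ i, (∑ z, f i (φ z (E x z))) / D ≤ μ + w * ε := by
      calc ∑ i, (∑ z, f i (φ z (E x z))) / D ≤ ∑ i, ((∑ z, f i z) / v + ε) := by
            refine sum_le_sum fun i _ => not_lt.1 fun hlt => hx ?_
            exact mem_biUnion.2 ⟨i, mem_univ i, mem_filter.2 ⟨mem_univ x, hlt⟩⟩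
        _ = μ + w * ε := by rw [sum_add_distrib, hμ]; simp
    refine (hGl.mgf_le hD hℓ (fun i z => f i (φ z (E x z))) (fun i z => (hf i _).1)
      (fun i z => (hf i _).2) hmean hθ).trans ?_
    rw [hA, ← Real.exp_add]
    refine add_le_add (Real.exp_le_exp.2 (by nlinarith)) ?_
    refine mul_le_mul_of_nonneg_right (Real.exp_le_exp.2 ?_) (by positivity)
    have : 0 ≤ θ * w := by positivity
    linarith
  have hFbad : ∀ x, F x ≤ Real.exp (θ * w) := by
    intro x
    rw [hF]
    refine (div_le_iff₀ (by positivity)).2 ?_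
    calc ∑ y, Real.exp (θ * ∑ i, f i (φ (Gl y i) (E x (Gl y i))))
        ≤ ∑ _y : Fin ℓ → Fin D, Real.exp (θ * w) := by
          refine sum_le_sum fun y _ => Real.exp_le_exp.2 (mul_le_mul_of_nonneg_left ?_ hθ)
          calc ∑ i, f i (φ (Gl y i) (E x (Gl y i))) ≤ ∑ _i : Fin w, (1 : ℝ) :=
                sum_le_sum fun i _ => (hf i _).2
            _ = w := by simp
      _ = Real.exp (θ * w) * (D : ℝ) ^ ℓ := by simp [mul_comm]
  have hFle : ∀ x, F x ≤ A + if x ∈ B then Real.exp (θ * w) else 0 := by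
    intro x
    split_ifs with hx
    · linarith [hFbad x]
    · linarith [hFgood x hx]
  have hvc : (v : ℝ) ^ ((c : ℝ) / 2) / (v : ℝ) ^ c = (v : ℝ) ^ (-(c : ℝ) / 2) := by
    rw [← Real.rpow_natCast, ← Real.rpow_sub hvR]
    congr 1
    ring
  calc _ = (∑ x, F x) / (v : ℝ) ^ c := by
        rw [hF, ← sum_div, div_div, mul_comm ((D : ℝ) ^ ℓ)]
    _ ≤ (∑ x, (A + if x ∈ B then Real.exp (θ * w) else 0)) / (v : ℝ) ^ c := by
        gcongr with x
        exact hFle x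
    _ = A + Real.exp (θ * w) * B.card / (v : ℝ) ^ c := by
        rw [sum_add_distrib, sum_ite_mem, univ_inter, sum_const, sum_const, card_univ,
          Fintype.card_fin]
        simp only [nsmul_eq_mul, Nat.cast_pow]
        field_simp
    _ ≤ A + Real.exp (θ * w) * (w * (v : ℝ) ^ ((c : ℝ) / 2)) / (v : ℝ) ^ c := by gcongr
    _ = A + Real.exp (θ * w) * w * (v : ℝ) ^ (-(c : ℝ) / 2) := by
        rw [← hvc]
        ring
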